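/- Consider a transportation network with flow-density functions satisfying the standing assumptions, a throughput λ with 0 ≤ λ < C^mincut, and a Lipschitz decentralized monotone feedback pricing policy ω. For each β > 0, let Z_β ⊆ Z be a nonempty compact convex set contained in the relative interior Z° of Z with sup_{z∈Z_β} (Az)_i < C_i for each link i, and suppose Z_β converges to the closure of Z in the Hausdorff metric as β → ∞. Let z^β be the unique minimizer over Z_β of z ↦ Θ(z) + β^{-1} ∑_γ z_γ log z_γ, and set y^{(ω,β)} := A z^β. Then lim_{β→∞} y^{(ω,β)} = y^{(ω)}, the unique generalized Wardrop equilibrium of throughput λ for the pricing policy ω. -/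

import Mathlib

open Set Filter Topology

noncomputable section

namespace Traffic

/-- The standing assumptions on a flow-density function `φ`: twice continuously
differentiable, strictly increasing and strictly concave on `[0,∞)`, with `φ 0 = 0`
(finiteness of `φ'(0)` is automatic for real-valued `φ`). -/
def Standing (φ : ℝ → ℝ) : Prop :=
  ContDiffOn ℝ 2 φ (Set.Ici 0) ∧ StrictMonoOn φ (Set.Ici 0) ∧
    StrictConcaveOn ℝ (Set.Ici 0) φ ∧ φ 0 = 0

/-- The capacity `C = sup {φ x : x ≥ 0}`, as an extended nonnegative real. -/
def cap (φ : ℝ → ℝ) : ENNReal := ⨆ x ∈ Set.Ici (0:ℝ), ENNReal.ofReal (φ x)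

/-- The inverse of `φ` on `[0,∞)`. -/
def phiInv (φ : ℝ → ℝ) (y : ℝ) : ℝ := Function.invFunOn φ (Set.Ici 0) y

/-- The latency function `τ` associated to a flow-density function `φ`:
`τ 0 = 1/φ'(0)` and `τ y = φ⁻¹(y)/y` for `y ≠ 0`. -/
def latency (φ : ℝ → ℝ) (y : ℝ) : ℝ :=
  if y = 0 then 1 / derivWithin φ (Set.Ici 0) 0 else phiInv φ y / y

/-- The domain `[0, C)` of the latency function. -/
def latDom (φ : ℝ → ℝ) : Set ℝ := {y | 0 ≤ y ∧ ENNReal.ofReal y < cap φ}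

variable {V E : Type*}

/-- Node-link incidence matrix. -/
def Bmat [DecidableEq V] (θ κ : E → V) (v : V) (i : E) : ℝ :=
  if v = θ i then 1 else if v = κ i then -1 else 0

/-- `p` is a simple path from `o` to `d`: nonempty list of links, starting at `o`,
ending at `d`, consecutive, and visiting no node twice. -/
def IsSimplePath (θ κ : E → V) (o d : V) (p : List E) : Prop :=
  p ≠ [] ∧ (p.map θ).head? = some o ∧ (p.map κ).getLast? = some d ∧
    List.Chain' (fun a b => κ a = θ b) p ∧ (o :: p.map κ).Nodup

/-- The type of simple paths from `o` to `d`. -/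
abbrev Path (θ κ : E → V) (o d : V) := {p : List E // IsSimplePath θ κ o d p}

/-- Link-path incidence matrix. -/
def Amat [DecidableEq E] (θ κ : E → V) (o d : V) (i : E) (γ : Path θ κ o d) : ℝ :=
  if i ∈ γ.1 then 1 else 0

/-- The flow `y^z = A z` associated to a path preference vector `z`. -/
def flowOf [Fintype E] [DecidableEq E] (θ κ : E → V) (o d : V) [Fintype (Path θ κ o d)]
    (z : Path θ κ o d → ℝ) (i : E) : ℝ :=
  ∑ γ, Amat θ κ o d i γ * z γ

/-- The simplex `S_λ` of path preference vectors of total mass `lam`. -/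
def pathSimplex (lam : ℝ) (Γ : Type*) [Fintype Γ] : Set (Γ → ℝ) :=
  {z | (∀ γ, 0 ≤ z γ) ∧ ∑ γ, z γ = lam}

/-- The set `F` of feasible flows. -/
def feas [Fintype E] (φ : E → ℝ → ℝ) : Set (E → ℝ) :=
  {y | ∀ i, 0 ≤ y i ∧ ENNReal.ofReal (y i) < cap (φ i)}

/-- The set of `o`-`d` equilibrium flow vectors of throughput `lam`. -/
def eqFlow [Fintype E] [DecidableEq V] (θ κ : E → V) (o d : V) (lam : ℝ) :
    Set (E → ℝ) :=
  {y | (∀ i, 0 ≤ y i) ∧ ∀ v, (∑ i, Bmat θ κ v i * y i) =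
      lam * ((if v = o then (1:ℝ) else 0) - (if v = d then 1 else 0))}

/-- The min-cut capacity between `o` and `d`. -/
def minCut [Fintype V] [Fintype E] [DecidableEq V] (θ κ : E → V) (o d : V)
    (φ : E → ℝ → ℝ) : ENNReal :=
  ⨅ U ∈ {U : Finset V | o ∈ U ∧ d ∉ U},
    ∑ i ∈ Finset.univ.filter (fun i => θ i ∈ U ∧ κ i ∉ U), cap (φ i)

/-- The total latency `L(y) = ∑ i, y i * τ_i (y i)`. -/
def totLat [Fintype E] (φ : E → ℝ → ℝ) (y : E → ℝ) : ℝ :=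
  ∑ i, y i * latency (φ i) (y i)

/-- A decentralized monotone feedback pricing policy: on each link, a nondecreasing
nonnegative function of the flow on that link only. -/
def MonotonePolicy [Fintype E] (φ ω : E → ℝ → ℝ) : Prop :=
  ∀ i, MonotoneOn (ω i) (latDom (φ i)) ∧ ∀ y ∈ latDom (φ i), 0 ≤ ω i y

/-- A Lipschitz (decentralized) pricing policy. -/
def LipschitzPolicy [Fintype E] (φ ω : E → ℝ → ℝ) : Prop :=
  ∀ i, ∃ K : NNReal, LipschitzOnWith K (ω i) (latDom (φ i))

/-- Perceived cost (total latency plus total toll) of path `γ` at flow `y`. -/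
def pathCost [Fintype E] [DecidableEq E] (θ κ : E → V) (o d : V)
    [Fintype (Path θ κ o d)] (φ ω : E → ℝ → ℝ) (y : E → ℝ) (γ : Path θ κ o d) : ℝ :=
  ∑ i, Amat θ κ o d i γ * (latency (φ i) (y i) + ω i (y i))

/-- Generalized Wardrop equilibrium with feedback pricing. -/
def IsGWE [Fintype E] [DecidableEq V] [DecidableEq E] (θ κ : E → V) (o d : V)
    [Fintype (Path θ κ o d)] (φ ω : E → ℝ → ℝ) (lam : ℝ) (y : E → ℝ) : Prop :=
  y ∈ feas φ ∧ y ∈ eqFlow θ κ o d lam ∧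
    ∃ z ∈ pathSimplex lam (Path θ κ o d), (∀ i, y i = flowOf θ κ o d z i) ∧
      ∀ γ, 0 < z γ → ∀ γ', pathCost θ κ o d φ ω y γ ≤ pathCost θ κ o d φ ω y γ'

/-- The local routing split `G_j(z)`. -/
def Gsplit [Fintype E] [DecidableEq V] [DecidableEq E] (θ κ : E → V) (o d : V)
    [Fintype (Path θ κ o d)] (z : Path θ κ o d → ℝ) (j : E) : ℝ :=
  if 0 < ∑ i ∈ Finset.univ.filter (fun i => θ i = θ j), flowOf θ κ o d z i then
    flowOf θ κ o d z j / ∑ i ∈ Finset.univ.filter (fun i => θ i = θ j), flowOf θ κ o d z i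
  else 1 / (Finset.univ.filter (fun i => θ i = θ j)).card

/-- The drift `H_i(y, z)` of the fast-scale traffic dynamics. -/
def drift [Fintype E] [DecidableEq V] [DecidableEq E] (θ κ : E → V) (o d : V)
    [Fintype (Path θ κ o d)] (lam : ℝ) (z : Path θ κ o d → ℝ) (y : E → ℝ) (i : E) : ℝ :=
  Gsplit θ κ o d z i * (lam * (if θ i = o then 1 else 0)
      + ∑ j ∈ Finset.univ.filter (fun j => κ j = θ i), y j) - y i

/-- The set `Z` of feasible path preferences. -/
def Zfeas [Fintype E] [DecidableEq E] (θ κ : E → V) (o d : V)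
    [Fintype (Path θ κ o d)] (φ : E → ℝ → ℝ) (lam : ℝ) : Set (Path θ κ o d → ℝ) :=
  {z ∈ pathSimplex lam (Path θ κ o d) | (fun i => flowOf θ κ o d z i) ∈ feas φ}

/-- The relative interior `Z°` of `Z`. -/
def Zint [Fintype E] [DecidableEq E] (θ κ : E → V) (o d : V)
    [Fintype (Path θ κ o d)] (φ : E → ℝ → ℝ) (lam : ℝ) : Set (Path θ κ o d → ℝ) :=
  {z ∈ Zfeas θ κ o d φ lam | ∀ γ, 0 < z γ}

/-- Euclidean norm of a vector indexed by a finite type. -/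
def euclNorm {α : Type*} [Fintype α] (v : α → ℝ) : ℝ := Real.sqrt (∑ a, v a ^ 2)

/-- The `γ` component of the projected gradient `Φ ∇h(z)` of `h` (derivative taken
within `Zh`), where `Φ = I - |Γ|⁻¹ 𝟙𝟙'`. -/
def projGrad {Γ : Type*} [Fintype Γ] [DecidableEq Γ] (h : (Γ → ℝ) → ℝ)
    (Zh : Set (Γ → ℝ)) (z : Γ → ℝ) (γ : Γ) : ℝ :=
  fderivWithin ℝ h Zh z (fun γ' => (if γ' = γ then (1:ℝ) else 0) - 1 / (Fintype.card Γ : ℝ))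

/-- `h` is an admissible perturbation with domain `Zh ⊆ Zset`: closed convex domain,
strictly convex, twice continuously differentiable on the (intrinsic) interior of its
domain, with projected gradient blowing up at the (intrinsic) boundary. -/
def Admissible {Γ : Type*} [Fintype Γ] [DecidableEq Γ] (Zset Zh : Set (Γ → ℝ))
    (h : (Γ → ℝ) → ℝ) : Prop :=
  Zh ⊆ Zset ∧ IsClosed Zh ∧ Convex ℝ Zh ∧ StrictConvexOn ℝ Zh h ∧
    ContDiffOn ℝ 2 h (intrinsicInterior ℝ Zh) ∧
    ∀ z₀ ∈ intrinsicFrontier ℝ Zh,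
      Tendsto (fun z => euclNorm (projGrad h Zh z))
        (nhdsWithin z₀ (intrinsicInterior ℝ Zh)) atTop

/-- `Fh` is the perturbed best response associated to the admissible perturbation `h`
with domain `Zh`: for all latencies `l` and tolls `w`, `Fh l w` is the unique minimizer
over `Zh` of `α ↦ α' A' (l + w) + h α`. -/
def IsPerturbedBR [Fintype E] [DecidableEq E] (θ κ : E → V) (o d : V)
    [Fintype (Path θ κ o d)] (Zh : Set (Path θ κ o d → ℝ)) (h : (Path θ κ o d → ℝ) → ℝ)
    (Fh : (E → ℝ) → (E → ℝ) → (Path θ κ o d → ℝ)) : Prop :=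
  ∀ l w : E → ℝ, Fh l w ∈ Zh ∧ ∀ α ∈ Zh, α ≠ Fh l w →
    (∑ γ, Fh l w γ * (∑ i, Amat θ κ o d i γ * (l i + w i)) + h (Fh l w)) <
      (∑ γ, α γ * (∑ i, Amat θ κ o d i γ * (l i + w i)) + h α)

/-- A solution of the closed-loop multiscale dynamics with update rate `η`:
locally Lipschitz trajectories `x(t)` (densities) and `z(t)` (path preferences)
with `z(t) ∈ S_λ`, `x(t) ≥ 0`, satisfying `ẋ = H(φ(x), z)` and
`ż = η (Fh(l, w) - z)` for `l_i = τ_i(y_i)`, `w_i = ω_i(y_i)`, `y = φ(x)`. -/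
def IsSolution [Fintype E] [DecidableEq V] [DecidableEq E] (θ κ : E → V) (o d : V)
    [Fintype (Path θ κ o d)] (φ ω : E → ℝ → ℝ) (lam η : ℝ)
    (Fh : (E → ℝ) → (E → ℝ) → (Path θ κ o d → ℝ))
    (x : ℝ → E → ℝ) (z : ℝ → Path θ κ o d → ℝ) : Prop :=
  LocallyLipschitz x ∧ LocallyLipschitz z ∧
    (∀ t ≥ (0:ℝ), z t ∈ pathSimplex lam (Path θ κ o d)) ∧
    (∀ t ≥ (0:ℝ), ∀ i, 0 ≤ x t i) ∧
    (∀ t ≥ (0:ℝ), ∀ i, HasDerivWithinAt (fun s => x s i)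
        (drift θ κ o d lam (z t) (fun j => φ j (x t j)) i) (Set.Ici 0) t) ∧
    (∀ t ≥ (0:ℝ), ∀ γ, HasDerivWithinAt (fun s => z s γ)
        (η * (Fh (fun i => latency (φ i) (φ i (x t i)))
            (fun i => ω i (φ i (x t i))) γ - z t γ)) (Set.Ici 0) t)

/-- The potential `Θ(z) = ∑ i ∫_0^{(Az)_i} (τ_i + ω_i)`. -/
def Theta [Fintype E] [DecidableEq E] (θ κ : E → V) (o d : V)
    [Fintype (Path θ κ o d)] (φ ω : E → ℝ → ℝ) (z : Path θ κ o d → ℝ) : ℝ :=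
  ∑ i, ∫ s in (0:ℝ)..(flowOf θ κ o d z i), (latency (φ i) s + ω i s)

/-- The entropic objective `Θ(z) + β⁻¹ ∑ γ z_γ log z_γ`. -/
def entObj [Fintype E] [DecidableEq E] (θ κ : E → V) (o d : V)
    [Fintype (Path θ κ o d)] (φ ω : E → ℝ → ℝ) (β : ℝ) (z : Path θ κ o d → ℝ) : ℝ :=
  Theta θ κ o d φ ω z + β⁻¹ * ∑ γ, z γ * Real.log (z γ)


section Latency

variable {φ : ℝ → ℝ}

lemma Standing.pos (h : Standing φ) {x : ℝ} (hx : 0 < x) : 0 < φ x := by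
  have := h.2.1 (mem_Ici.2 le_rfl) (mem_Ici.2 hx.le) hx
  rwa [h.2.2.2] at this

lemma Standing.nonneg (h : Standing φ) {x : ℝ} (hx : 0 ≤ x) : 0 ≤ φ x := by
  rcases hx.eq_or_lt with rfl | hx
  · exact h.2.2.2.ge
  · exact (h.pos hx).le

lemma Standing.mem_latDom_iff (h : Standing φ) {y : ℝ} :
    y ∈ latDom φ ↔ ∃ x, 0 ≤ x ∧ φ x = y := by
  constructor
  · rintro ⟨hy0, hy⟩
    simp only [cap, lt_iSup_iff] at hy
    obtain ⟨x, hx, hxy⟩ := hy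
    have hyx : y < φ x := (ENNReal.ofReal_lt_ofReal_iff_of_nonneg hy0).1 hxy
    have hx0 : (0 : ℝ) ≤ x := hx
    have hc : ContinuousOn φ (Icc 0 x) := h.1.continuousOn.mono fun t ht => ht.1
    obtain ⟨t, ht, hty⟩ := intermediate_value_Icc hx0 hc
      (show y ∈ Icc (φ 0) (φ x) from ⟨by rw [h.2.2.2]; exact hy0, hyx.le⟩)
    exact ⟨t, ht.1, hty⟩
  · rintro ⟨x, hx, rfl⟩
    refine ⟨h.nonneg hx, ?_⟩
    have hlt : φ x < φ (x + 1) :=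
      h.2.1 (mem_Ici.2 hx) (mem_Ici.2 (by linarith)) (by linarith)
    calc ENNReal.ofReal (φ x) < ENNReal.ofReal (φ (x + 1)) :=
          (ENNReal.ofReal_lt_ofReal_iff_of_nonneg (h.nonneg hx)).2 hlt
      _ ≤ cap φ := le_iSup₂ (f := fun x (_ : x ∈ Ici (0 : ℝ)) => ENNReal.ofReal (φ x))
          (x + 1) (mem_Ici.2 (by linarith))

lemma Standing.phiInv_apply (h : Standing φ) {x : ℝ} (hx : 0 ≤ x) : phiInv φ (φ x) = x :=
  h.2.1.injOn.leftInvOn_invFunOn (mem_Ici.2 hx)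

lemma Standing.hasDerivWithinAt_zero (h : Standing φ) :
    HasDerivWithinAt φ (derivWithin φ (Ici 0) 0) (Ici 0) 0 :=
  ((h.1.differentiableOn (by norm_num)) 0 (mem_Ici.2 le_rfl)).hasDerivWithinAt

lemma Standing.div_anti (h : Standing φ) {x y : ℝ} (hx : 0 < x) (hxy : x < y) :
    φ y / y < φ x / x := by
  have := h.2.2.1.secant_strict_mono (a := 0) (x := x) (y := y) (mem_Ici.2 le_rfl)
    (mem_Ici.2 hx.le) (mem_Ici.2 (hx.trans hxy).le) hx.ne' (hx.trans hxy).ne' hxy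
  simpa [h.2.2.2] using this

lemma Standing.tendsto_div (h : Standing φ) :
    Tendsto (fun x => φ x / x) (𝓝[>] 0) (𝓝 (derivWithin φ (Ici 0) 0)) := by
  have := (hasDerivWithinAt_iff_tendsto_slope' (s := Ioi (0 : ℝ)) self_notMem_Ioi).1
    (h.hasDerivWithinAt_zero.mono Ioi_subset_Ici_self)
  refine this.congr fun x => ?_
  simp [slope_def_field, h.2.2.2]

lemma Standing.div_lt_deriv (h : Standing φ) {x : ℝ} (hx : 0 < x) :
    φ x / x < derivWithin φ (Ici 0) 0 := by
  refine (h.div_anti (half_pos hx) (half_lt_self hx)).trans_le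
    (ge_of_tendsto h.tendsto_div ?_)
  filter_upwards [Ioo_mem_nhdsGT (half_pos hx)] with t ht
  exact (h.div_anti ht.1 ht.2).le

lemma Standing.deriv_pos (h : Standing φ) : 0 < derivWithin φ (Ici 0) 0 :=
  (div_pos (h.pos one_pos) one_pos).trans (h.div_lt_deriv one_pos)

lemma Standing.latency_apply (h : Standing φ) {x : ℝ} (hx : 0 < x) :
    latency φ (φ x) = x / φ x := by
  rw [latency, if_neg (h.pos hx).ne', h.phiInv_apply hx.le]

lemma Standing.strictMonoOn_latency (h : Standing φ) : StrictMonoOn (latency φ) (latDom φ) := by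
  intro y hy y' hy' hlt
  obtain ⟨x, hx, rfl⟩ := h.mem_latDom_iff.1 hy
  obtain ⟨x', hx', rfl⟩ := h.mem_latDom_iff.1 hy'
  have hxx : x < x' := (h.2.1.lt_iff_lt hx hx').1 hlt
  have hx0 : 0 < x' := hx.trans_lt hxx
  rw [h.latency_apply hx0]
  have hpos := div_pos (h.pos hx0) hx0
  rw [← inv_div]
  rcases hx.eq_or_lt with rfl | hx
  · rw [h.2.2.2, latency, if_pos rfl, one_div]
    exact inv_strictAnti₀ hpos (h.div_lt_deriv hx0)
  · rw [h.latency_apply hx, ← inv_div (φ x)]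
    exact inv_strictAnti₀ hpos (h.div_anti hx hxx)

lemma Standing.latency_nonneg (h : Standing φ) {y : ℝ} (hy : y ∈ latDom φ) :
    0 ≤ latency φ y := by
  obtain ⟨x, hx, rfl⟩ := h.mem_latDom_iff.1 hy
  rcases hx.eq_or_lt with rfl | hx
  · rw [h.2.2.2, latency, if_pos rfl]
    exact (one_div_pos.2 h.deriv_pos).le
  · rw [h.latency_apply hx]
    exact (div_pos hx (h.pos hx)).le

lemma Standing.continuousOn_phiInv (h : Standing φ) : ContinuousOn (phiInv φ) (latDom φ) := by
  intro y hy
  obtain ⟨x, hx, rfl⟩ := h.mem_latDom_iff.1 hy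
  rw [ContinuousWithinAt, h.phiInv_apply hx, tendsto_order]
  constructor
  · intro a ha
    rcases lt_or_ge a 0 with ha0 | ha0
    · filter_upwards [self_mem_nhdsWithin] with y' hy'
      obtain ⟨x', hx', rfl⟩ := h.mem_latDom_iff.1 hy'
      rw [h.phiInv_apply hx']
      exact ha0.trans_le hx'
    · have : φ a < φ x := h.2.1 ha0 hx ha
      filter_upwards [self_mem_nhdsWithin, mem_nhdsWithin_of_mem_nhds (Ioi_mem_nhds this)]
        with y' hy' hlt
      obtain ⟨x', hx', rfl⟩ := h.mem_latDom_iff.1 hy'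
      rw [h.phiInv_apply hx']
      exact (h.2.1.lt_iff_lt ha0 hx').1 hlt
  · intro b hb
    have hb0 : 0 ≤ b := hx.trans hb.le
    have : φ x < φ b := h.2.1 hx hb0 hb
    filter_upwards [self_mem_nhdsWithin, mem_nhdsWithin_of_mem_nhds (Iio_mem_nhds this)]
      with y' hy' hlt
    obtain ⟨x', hx', rfl⟩ := h.mem_latDom_iff.1 hy'
    rw [h.phiInv_apply hx']
    exact (h.2.1.lt_iff_lt hx' hb0).1 hlt

lemma Standing.continuousOn_latency (h : Standing φ) :
    ContinuousOn (latency φ) (latDom φ) := by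
  intro y hy
  rcases hy.1.eq_or_lt with rfl | hy0
  · have hinv : phiInv φ 0 = 0 := by simpa [h.2.2.2] using h.phiInv_apply le_rfl
    rw [← continuousWithinAt_sdiff_self]
    have hlim : Tendsto (phiInv φ) (𝓝[latDom φ \ {0}] 0) (𝓝[>] 0) := by
      refine tendsto_nhdsWithin_iff.2 ⟨?_, ?_⟩
      · have := (h.continuousOn_phiInv 0 hy).mono (sdiff_subset (t := {0}))
        rwa [ContinuousWithinAt, hinv] at this
      · filter_upwards [self_mem_nhdsWithin] with y' hy'
        obtain ⟨x', hx', rfl⟩ := h.mem_latDom_iff.1 hy'.1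
        rw [h.phiInv_apply hx']
        refine hx'.lt_of_ne fun h0 => hy'.2 ?_
        rw [← h0, h.2.2.2]
        rfl
    have := (h.tendsto_div.inv₀ h.deriv_pos.ne').comp hlim
    rw [ContinuousWithinAt, latency, if_pos rfl, one_div]
    refine this.congr' ?_
    filter_upwards [self_mem_nhdsWithin] with y' hy'
    obtain ⟨x', hx', rfl⟩ := h.mem_latDom_iff.1 hy'.1
    simp only [Function.comp, latency]
    rw [if_neg (show φ x' ≠ 0 from hy'.2), h.phiInv_apply hx', inv_div]
  · have : ContinuousWithinAt (fun y => phiInv φ y / y) (latDom φ) y :=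
      (h.continuousOn_phiInv y hy).div continuousWithinAt_id hy0.ne'
    refine this.congr_of_eventuallyEq ?_ (if_neg hy0.ne')
    filter_upwards [mem_nhdsWithin_of_mem_nhds (Ioi_mem_nhds hy0)] with y' hy'
    exact if_neg (ne_of_gt hy')

lemma Standing.exists_latency_mul_gt (h : Standing φ) {y : ℝ} (hy : y ∈ latDom φ) (M : ℝ) :
    ∃ r ∈ latDom φ, y < r ∧ M < latency φ r * (r - y) := by
  obtain ⟨x, hx, rfl⟩ := h.mem_latDom_iff.1 hy
  have hx1 : φ x < φ (x + 1) := h.2.1 hx (mem_Ici.2 (by linarith)) (by linarith)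
  have hp1 : 0 < φ (x + 1) := h.pos (by linarith)
  have hc : 0 < 1 - φ x / φ (x + 1) := by
    rw [sub_pos, div_lt_one hp1]
    exact hx1
  obtain ⟨t, htx, htM⟩ : ∃ t, x + 1 < t ∧ M < t * (1 - φ x / φ (x + 1)) := by
    refine ⟨max (x + 1) (M / (1 - φ x / φ (x + 1))) + 1, ?_, ?_⟩
    · linarith [le_max_left (x + 1) (M / (1 - φ x / φ (x + 1)))]
    · rw [← div_lt_iff₀ hc]
      linarith [le_max_right (x + 1) (M / (1 - φ x / φ (x + 1)))]
  have ht0 : 0 < t := by linarith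
  have htφ : φ (x + 1) < φ t := h.2.1 (mem_Ici.2 (by linarith)) (mem_Ici.2 ht0.le) htx
  refine ⟨φ t, h.mem_latDom_iff.2 ⟨t, ht0.le, rfl⟩, hx1.trans htφ, htM.trans_le ?_⟩
  have hpt := h.pos ht0
  rw [h.latency_apply ht0, show t / φ t * (φ t - φ x) = t * (1 - φ x / φ t) by field_simp]
  have := h.nonneg hx
  gcongr

end Latency

/-- The properties of a link cost function (latency plus toll) on the flow domain `D` that the
equilibrium analysis relies on. -/
structure LinkCost (f : ℝ → ℝ) (D : Set ℝ) : Prop where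
  subset_Ici : D ⊆ Ici 0
  mem_of_le : ∀ {a b}, 0 ≤ a → a ≤ b → b ∈ D → a ∈ D
  continuousOn : ContinuousOn f D
  strictMonoOn : StrictMonoOn f D
  nonneg : ∀ {y}, y ∈ D → 0 ≤ f y
  exists_mul_gt : ∀ {y}, y ∈ D → ∀ M, ∃ r ∈ D, y < r ∧ M < f r * (r - y)

lemma Standing.linkCost {φ ω : ℝ → ℝ} (h : Standing φ) (hmon : MonotoneOn ω (latDom φ))
    (hω : ∀ y ∈ latDom φ, 0 ≤ ω y) (hcont : ContinuousOn ω (latDom φ)) :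
    LinkCost (fun y => latency φ y + ω y) (latDom φ) where
  subset_Ici _ hy := hy.1
  mem_of_le ha hab hb := ⟨ha, (ENNReal.ofReal_le_ofReal hab).trans_lt hb.2⟩
  continuousOn := h.continuousOn_latency.add hcont
  strictMonoOn := h.strictMonoOn_latency.add_monotone hmon
  nonneg hy := add_nonneg (h.latency_nonneg hy) (hω _ hy)
  exists_mul_gt {y} hy M := by
    obtain ⟨r, hr, hyr, hM⟩ := h.exists_latency_mul_gt hy M
    refine ⟨r, hr, hyr, hM.trans_le ?_⟩
    have := hω r hr
    have : 0 ≤ r - y := by linarith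
    gcongr
    linarith

namespace LinkCost

variable {f : ℝ → ℝ} {D : Set ℝ}

lemma uIcc_subset (h : LinkCost f D) {a b : ℝ} (ha : a ∈ D) (hb : b ∈ D) : uIcc a b ⊆ D := by
  intro t ht
  have h0 := h.subset_Ici ha
  have h1 := h.subset_Ici hb
  rcases le_total a b with hab | hab
  · rw [uIcc_of_le hab] at ht
    exact h.mem_of_le (le_trans h0 ht.1) ht.2 hb
  · rw [uIcc_of_ge hab] at ht
    exact h.mem_of_le (le_trans h1 ht.1) ht.2 ha

lemma zero_mem (h : LinkCost f D) {a : ℝ} (ha : a ∈ D) : 0 ∈ D :=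
  h.mem_of_le le_rfl (h.subset_Ici ha) ha

lemma intervalIntegrable (h : LinkCost f D) {a b : ℝ} (ha : a ∈ D) (hb : b ∈ D) :
    IntervalIntegrable f MeasureTheory.volume a b :=
  (h.continuousOn.mono (h.uIcc_subset ha hb)).intervalIntegrable

lemma integral_sub (h : LinkCost f D) {a b : ℝ} (ha : a ∈ D) (hb : b ∈ D) :
    (∫ s in (0:ℝ)..b, f s) - ∫ s in (0:ℝ)..a, f s = ∫ s in a..b, f s :=
  intervalIntegral.integral_interval_sub_left (h.intervalIntegrable (h.zero_mem hb) hb)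
    (h.intervalIntegrable (h.zero_mem ha) ha)

lemma bounds_of_le (h : LinkCost f D) {a b : ℝ} (ha : a ∈ D) (hb : b ∈ D) (hab : a ≤ b) :
    f a * (b - a) ≤ ∫ s in a..b, f s ∧ ∫ s in a..b, f s ≤ f b * (b - a) := by
  have hi := h.intervalIntegrable ha hb
  have hsub := h.uIcc_subset ha hb
  rw [uIcc_of_le hab] at hsub
  constructor
  · have := intervalIntegral.integral_mono_on hab (intervalIntegrable_const (c := f a)) hi
      fun x hx => h.strictMonoOn.monotoneOn ha (hsub hx) hx.1
    simpa [mul_comm] using this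
  · have := intervalIntegral.integral_mono_on hab hi (intervalIntegrable_const (c := f b))
      fun x hx => h.strictMonoOn.monotoneOn (hsub hx) hb hx.2
    simpa [mul_comm] using this

lemma mul_le_integral_sub (h : LinkCost f D) {a b : ℝ} (ha : a ∈ D) (hb : b ∈ D) :
    f a * (b - a) ≤ (∫ s in (0:ℝ)..b, f s) - ∫ s in (0:ℝ)..a, f s := by
  rcases le_total a b with hab | hab
  · rw [h.integral_sub ha hb]
    exact (h.bounds_of_le ha hb hab).1
  · have := (h.bounds_of_le hb ha hab).2
    rw [← h.integral_sub hb ha] at this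
    linarith

lemma integral_sub_le_mul (h : LinkCost f D) {a b : ℝ} (ha : a ∈ D) (hb : b ∈ D) :
    (∫ s in (0:ℝ)..b, f s) - (∫ s in (0:ℝ)..a, f s) ≤ f b * (b - a) := by
  linarith [h.mul_le_integral_sub hb ha]

lemma continuousOn_integral (h : LinkCost f D) :
    ContinuousOn (fun y => ∫ s in (0:ℝ)..y, f s) D := by
  intro a ha
  have hsub : Tendsto (fun y => y - a) (𝓝[D] a) (𝓝 0) := by
    have : ContinuousWithinAt (fun y => y - a) D a := by fun_prop
    simpa [ContinuousWithinAt] using this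
  have h1 : Tendsto (fun y => f a * (y - a)) (𝓝[D] a) (𝓝 0) := by
    simpa using hsub.const_mul (f a)
  have h2 : Tendsto (fun y => f y * (y - a)) (𝓝[D] a) (𝓝 0) := by
    simpa using Tendsto.mul (h.continuousOn a ha) hsub
  have := tendsto_of_tendsto_of_tendsto_of_le_of_le' h1 h2
    (by filter_upwards [self_mem_nhdsWithin] with y hy using h.mul_le_integral_sub ha hy)
    (by filter_upwards [self_mem_nhdsWithin] with y hy using h.integral_sub_le_mul ha hy)
  simpa [ContinuousWithinAt] using this.add_const (∫ s in (0:ℝ)..a, f s)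

/-- A flow whose Bregman gap to `a` is small is close to `a`. -/
lemma exists_gap (h : LinkCost f D) {a ε : ℝ} (ha : a ∈ D) (hε : 0 < ε) :
    ∃ δ > 0, ∀ y ∈ D,
      (∫ s in (0:ℝ)..y, f s) - (∫ s in (0:ℝ)..a, f s) - f a * (y - a) < δ → |y - a| < ε := by
  have key : ∀ y ∈ D, ∀ c ∈ D, (∫ s in (0:ℝ)..y, f s) - (∫ s in (0:ℝ)..a, f s)
      - f a * (y - a) ≥ (f c - f a) * (y - c) := by
    intro y hy c hc
    have h1 := h.mul_le_integral_sub ha hc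
    have h2 := h.mul_le_integral_sub hc hy
    linarith
  have hR : ∃ δ > 0, ∀ y ∈ D, (∫ s in (0:ℝ)..y, f s) - (∫ s in (0:ℝ)..a, f s)
      - f a * (y - a) < δ → y < a + ε := by
    by_cases hc : a + ε / 2 ∈ D
    · have hpos : 0 < f (a + ε / 2) - f a :=
        sub_pos.2 (h.strictMonoOn ha hc (by linarith))
      refine ⟨(f (a + ε / 2) - f a) * (ε / 2), by positivity, fun y hy hlt => ?_⟩
      by_contra! hge
      have h1 := key y hy _ hc
      have : (f (a + ε / 2) - f a) * (ε / 2) ≤ (f (a + ε / 2) - f a) * (y - (a + ε / 2)) := by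
        gcongr
        linarith
      linarith
    · refine ⟨1, one_pos, fun y hy _ => ?_⟩
      by_contra! hge
      have := h.subset_Ici ha
      rw [mem_Ici] at this
      exact hc (h.mem_of_le (by linarith) (by linarith) hy)
  have hL : ∃ δ > 0, ∀ y ∈ D, (∫ s in (0:ℝ)..y, f s) - (∫ s in (0:ℝ)..a, f s)
      - f a * (y - a) < δ → a - ε < y := by
    by_cases hc0 : 0 ≤ a - ε / 2
    · have hc : a - ε / 2 ∈ D := h.mem_of_le hc0 (by linarith) ha
      have hpos : 0 < f a - f (a - ε / 2) :=
        sub_pos.2 (h.strictMonoOn hc ha (by linarith))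
      refine ⟨(f a - f (a - ε / 2)) * (ε / 2), by positivity, fun y hy hlt => ?_⟩
      by_contra! hge
      have h1 := key y hy _ hc
      have : (f a - f (a - ε / 2)) * (ε / 2) ≤ (f a - f (a - ε / 2)) * (a - ε / 2 - y) := by
        gcongr
        linarith
      linarith
    · refine ⟨1, one_pos, fun y hy _ => ?_⟩
      have := h.subset_Ici hy
      rw [mem_Ici] at this
      linarith
  obtain ⟨δ₁, hδ₁, h₁⟩ := hR
  obtain ⟨δ₂, hδ₂, h₂⟩ := hL
  refine ⟨min δ₁ δ₂, lt_min hδ₁ hδ₂, fun y hy hlt => abs_sub_lt_iff.2 ⟨?_, ?_⟩⟩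
  · linarith [h₁ y hy (hlt.trans_le (min_le_left _ _))]
  · linarith [h₂ y hy (hlt.trans_le (min_le_right _ _))]

end LinkCost

/-- First-order optimality condition for a separable sum of link potentials. -/
lemma sum_mul_nonneg_of_eventually_le {E : Type*} [Fintype E] {f : E → ℝ → ℝ} {D : E → Set ℝ}
    (hf : ∀ i, LinkCost (f i) (D i)) {y v : E → ℝ} (hy : ∀ i, y i ∈ D i)
    (h : ∀ᶠ t in 𝓝[>] (0 : ℝ), (∀ i, y i + t * v i ∈ D i) ∧
      ∑ i, (∫ s in (0:ℝ)..y i, f i s) ≤ ∑ i, ∫ s in (0:ℝ)..(y i + t * v i), f i s) :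
    0 ≤ ∑ i, f i (y i) * v i := by
  have hlim : Tendsto (fun t => ∑ i, f i (y i + t * v i) * v i) (𝓝[>] (0 : ℝ))
      (𝓝 (∑ i, f i (y i) * v i)) := by
    refine tendsto_finsetSum _ fun i _ => Tendsto.mul_const _ ?_
    refine Tendsto.comp ((hf i).continuousOn (y i) (hy i))
      (tendsto_nhdsWithin_iff.2 ⟨?_, h.mono fun t ht => ht.1 i⟩)
    have : Continuous fun t : ℝ => y i + t * v i := by fun_prop
    simpa using (this.tendsto 0).mono_left nhdsWithin_le_nhds
  refine ge_of_tendsto hlim ?_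
  filter_upwards [h, self_mem_nhdsWithin] with t ht ht0
  have h1 : ∑ i, ((∫ s in (0:ℝ)..(y i + t * v i), f i s) - ∫ s in (0:ℝ)..y i, f i s) ≤
      ∑ i, f i (y i + t * v i) * (y i + t * v i - y i) :=
    Finset.sum_le_sum fun i _ => (hf i).integral_sub_le_mul (hy i) (ht.1 i)
  have h2 : ∑ i, f i (y i + t * v i) * (y i + t * v i - y i) =
      t * ∑ i, f i (y i + t * v i) * v i := by
    rw [Finset.mul_sum]
    exact Finset.sum_congr rfl fun i _ => by ring
  rw [Finset.sum_sub_distrib, h2] at h1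
  exact nonneg_of_mul_nonneg_right (by linarith [ht.2]) ht0

/-- A vector of the simplex minimizes a linear cost iff it is supported on cheapest entries. -/
lemma supported_on_min_iff {Γ : Type*} [Fintype Γ] [Nonempty Γ] {lam : ℝ}
    {z : Γ → ℝ} (hz : z ∈ pathSimplex lam Γ) (c : Γ → ℝ) :
    (∀ γ, 0 < z γ → ∀ γ', c γ ≤ c γ') ↔
      ∀ w ∈ pathSimplex lam Γ, ∑ γ, z γ * c γ ≤ ∑ γ, w γ * c γ := by
  classical
  constructor
  · intro h w hw
    obtain ⟨m, hm⟩ := Finite.exists_min c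
    calc ∑ γ, z γ * c γ ≤ ∑ γ, z γ * c m := by
          refine Finset.sum_le_sum fun γ _ => ?_
          rcases (hz.1 γ).eq_or_lt with h0 | h0
          · simp [← h0]
          · exact mul_le_mul_of_nonneg_left (h γ h0 m) h0.le
      _ = ∑ γ, w γ * c m := by rw [← Finset.sum_mul, ← Finset.sum_mul, hz.2, hw.2]
      _ ≤ ∑ γ, w γ * c γ :=
          Finset.sum_le_sum fun γ _ => mul_le_mul_of_nonneg_left (hm γ) (hw.1 γ)
  · intro h γ hγ γ'
    have := h (fun k => z k + z γ * ((if k = γ' then 1 else 0) - if k = γ then 1 else 0))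
      ⟨fun k => ?_, ?_⟩
    · simp only [add_mul, mul_sub, sub_mul, Finset.sum_add_distrib, Finset.sum_sub_distrib,
        mul_ite, mul_one, mul_zero, ite_mul, zero_mul, Finset.sum_ite_eq', Finset.mem_univ,
        if_true] at this
      exact le_of_mul_le_mul_left (by linarith) hγ
    · have := hz.1 k
      beta_reduce
      rcases eq_or_ne k γ with rfl | hk
      · rw [if_pos rfl]
        split_ifs <;> linarith
      · rw [if_neg hk]
        split_ifs <;> linarith
    · simp [mul_sub, Finset.sum_add_distrib, hz.2]

lemma convex_pathSimplex {Γ : Type*} [Fintype Γ] (lam : ℝ) : Convex ℝ (pathSimplex lam Γ) := by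
  intro z hz w hw a b ha hb hab
  refine ⟨fun γ => ?_, ?_⟩
  · have := hz.1 γ
    have := hw.1 γ
    simp only [Pi.add_apply, Pi.smul_apply, smul_eq_mul]
    positivity
  · simp only [Pi.add_apply, Pi.smul_apply, smul_eq_mul, Finset.sum_add_distrib,
      ← Finset.mul_sum, hz.2, hw.2]
    rw [← add_mul, hab, one_mul]

lemma isCompact_pathSimplex {Γ : Type*} [Fintype Γ] (lam : ℝ) :
    IsCompact (pathSimplex lam Γ) := by
  refine (isCompact_Icc (a := (0 : Γ → ℝ)) (b := fun _ => lam)).of_isClosed_subset ?_ ?_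
  · simp only [pathSimplex, ofPred_and, ofPred_forall]
    exact (isClosed_iInter fun γ => isClosed_le continuous_const (continuous_apply γ)).inter
      (isClosed_eq (by fun_prop) continuous_const)
  · intro z hz
    refine ⟨hz.1, fun γ => ?_⟩
    rw [← hz.2]
    exact Finset.single_le_sum (fun k _ => hz.1 k) (Finset.mem_univ γ)

/-- The entropy is bounded on the simplex. -/
lemma exists_entropy_bound {Γ : Type*} [Fintype Γ] (lam : ℝ) :
    ∃ K, ∀ z ∈ pathSimplex lam Γ, |∑ γ, z γ * Real.log (z γ)| ≤ K := by
  have hc : Continuous fun z : Γ → ℝ => ∑ γ, z γ * Real.log (z γ) :=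
    continuous_finsetSum _ fun γ _ => Real.continuous_mul_log.comp (continuous_apply γ)
  obtain ⟨K, hK⟩ := (isCompact_pathSimplex lam).exists_bound_of_continuousOn hc.continuousOn
  exact ⟨K, hK⟩

lemma sum_map_Bmat [DecidableEq V] {θ κ : E → V} (hloop : ∀ i, θ i ≠ κ i) (v : V) :
    ∀ (p : List E) (u w : V), p ≠ [] → (p.map θ).head? = some u → (p.map κ).getLast? = some w →
      List.IsChain (fun a b => κ a = θ b) p →
      (p.map (Bmat θ κ v)).sum = (if v = u then (1 : ℝ) else 0) - if v = w then 1 else 0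
  | [], _, _, h, _, _, _ => absurd rfl h
  | [a], u, w, _, hu, hw, _ => by
    simp only [List.map_cons, List.map_nil, List.head?_cons, Option.some.injEq,
      List.getLast?_singleton] at hu hw
    subst hu hw
    have := hloop a
    simp only [Bmat, List.map_cons, List.map_nil, List.sum_cons, List.sum_nil]
    grind
  | a :: b :: q, u, w, _, hu, hw, hc => by
    rw [List.isChain_cons_cons] at hc
    have ih := sum_map_Bmat hloop v (b :: q) (θ b) w (by simp) (by simp)
      (by simpa using hw) hc.2
    simp only [List.map_cons, List.head?_cons, Option.some.injEq] at hu
    subst hu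
    rw [List.map_cons, List.sum_cons, ih, ← hc.1]
    have := hloop a
    simp only [Bmat]
    grind

lemma sum_Bmat_mul_Amat [Fintype E] [DecidableEq E] [DecidableEq V] {θ κ : E → V} {o d : V}
    (hloop : ∀ i, θ i ≠ κ i) (v : V) (γ : Path θ κ o d) :
    ∑ i, Bmat θ κ v i * Amat θ κ o d i γ =
      (if v = o then (1 : ℝ) else 0) - if v = d then 1 else 0 := by
  obtain ⟨p, hne, ho, hd, hc, hnd⟩ := γ
  have hp : p.Nodup := List.Nodup.of_map κ (List.nodup_cons.1 hnd).2
  rw [← sum_map_Bmat hloop v p o d hne ho hd hc, ← List.sum_toFinset _ hp]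
  simp only [Amat, mul_ite, mul_one, mul_zero]
  rw [← Finset.sum_filter]
  congr 1
  ext i
  simp

section Network

variable [Fintype E] [DecidableEq E] {θ κ : E → V} {o d : V} [Fintype (Path θ κ o d)]

lemma continuous_flowOf (i : E) : Continuous fun z => flowOf θ κ o d z i := by
  unfold flowOf
  fun_prop

lemma flowOf_nonneg {z : Path θ κ o d → ℝ} (hz : ∀ γ, 0 ≤ z γ) (i : E) :
    0 ≤ flowOf θ κ o d z i :=
  Finset.sum_nonneg fun γ _ => mul_nonneg (by unfold Amat; split_ifs <;> norm_num) (hz γ)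

lemma flowOf_add_smul_sub (z w : Path θ κ o d → ℝ) (t : ℝ) (i : E) :
    flowOf θ κ o d (z + t • (w - z)) i =
      flowOf θ κ o d z i + t * (flowOf θ κ o d w i - flowOf θ κ o d z i) := by
  simp only [flowOf, Pi.add_apply, Pi.smul_apply, Pi.sub_apply, smul_eq_mul, mul_add, mul_sub,
    Finset.sum_add_distrib, Finset.sum_sub_distrib, Finset.mul_sum]
  simp only [mul_left_comm]

lemma exists_variational_equilibrium {f : E → ℝ → ℝ} {D : E → Set ℝ}
    (hf : ∀ i, LinkCost (f i) (D i)) {lam : ℝ} {z₀ : Path θ κ o d → ℝ}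
    (hz₀ : z₀ ∈ pathSimplex lam (Path θ κ o d)) (hD : ∀ i, flowOf θ κ o d z₀ i ∈ D i) :
    ∃ z ∈ pathSimplex lam (Path θ κ o d), (∀ i, flowOf θ κ o d z i ∈ D i) ∧
      ∀ w ∈ pathSimplex lam (Path θ κ o d), 0 ≤ ∑ i, f i (flowOf θ κ o d z i) *
        (flowOf θ κ o d w i - flowOf θ κ o d z i) := by
  set F := flowOf θ κ o d with hF
  set M := ∑ i, f i (F z₀ i) * F z₀ i
  choose r hrD hr hrM using fun i => (hf i).exists_mul_gt (hD i) M
  set K : Set (Path θ κ o d → ℝ) := pathSimplex lam (Path θ κ o d) ∩ {z | ∀ i, F z i ≤ r i}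
  have hKD : ∀ z ∈ K, ∀ i, F z i ∈ D i := fun z hz i =>
    (hf i).mem_of_le (flowOf_nonneg hz.1.1 i) (hz.2 i) (hrD i)
  have hKc : IsCompact K := by
    refine (isCompact_pathSimplex lam).inter_right ?_
    simp only [ofPred_forall]
    exact isClosed_iInter fun i => isClosed_le (continuous_flowOf i) continuous_const
  have hcont : ContinuousOn (fun z => ∑ i, ∫ s in (0:ℝ)..F z i, f i s) K :=
    continuousOn_finsetSum _ fun i _ => (hf i).continuousOn_integral.comp
      (continuous_flowOf i).continuousOn fun z hz => hKD z hz i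
  obtain ⟨z, hzK, hmin⟩ := hKc.exists_isMinOn ⟨z₀, hz₀, fun i => (hr i).le⟩ hcont
  have hseg : ∀ w ∈ pathSimplex lam (Path θ κ o d),
      (∀ᶠ t in 𝓝[>] (0 : ℝ), ∀ i, F (z + t • (w - z)) i ≤ r i) →
      0 ≤ ∑ i, f i (F z i) * (F w i - F z i) := by
    intro w hw hev
    refine sum_mul_nonneg_of_eventually_le hf (hKD z hzK) ?_
    filter_upwards [hev, Ioo_mem_nhdsGT (one_pos (α := ℝ))] with t ht ht1
    have hmem : z + t • (w - z) ∈ K :=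
      ⟨(convex_pathSimplex lam).add_smul_sub_mem hzK.1 hw ⟨ht1.1.le, ht1.2.le⟩, ht⟩
    simp only [hF, ← flowOf_add_smul_sub]
    exact ⟨hKD _ hmem, hmin hmem⟩
  have hlt : ∀ j, F z j < r j := by
    intro j
    refine (hzK.2 j).lt_of_ne fun hj => ?_
    have h0 := hseg z₀ hz₀ <| by
      filter_upwards [Ioo_mem_nhdsGT (one_pos (α := ℝ))] with t ht i
      rw [hF, flowOf_add_smul_sub]
      have h1 := hzK.2 i
      have h2 := (hr i).le
      rw [← hF]
      nlinarith [ht.1, ht.2]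
    classical
    have hterm : ∀ i, f i (F z i) * (F z₀ i - F z i) ≤ f i (F z₀ i) * F z₀ i := by
      intro i
      have hz0 := flowOf_nonneg hzK.1.1 i
      have hz00 := flowOf_nonneg hz₀.1 i
      have hfz := (hf i).nonneg (hKD z hzK i)
      have hfz₀ := (hf i).nonneg (hD i)
      rcases le_total (F z i) (F z₀ i) with hle | hle
      · exact mul_le_mul ((hf i).strictMonoOn.monotoneOn (hKD z hzK i) (hD i) hle)
          (sub_le_self _ hz0) (sub_nonneg.2 hle) hfz₀
      · exact (mul_nonpos_of_nonneg_of_nonpos hfz (sub_nonpos.2 hle)).trans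
          (mul_nonneg hfz₀ hz00)
    have hsum : ∑ i, f i (F z i) * (F z₀ i - F z i) <
        ∑ i, (f i (F z₀ i) * F z₀ i - if i = j then M else 0) := by
      have hjlt : f j (F z j) * (F z₀ j - F z j) < f j (F z₀ j) * F z₀ j - M := by
        have := mul_nonneg ((hf j).nonneg (hD j)) (flowOf_nonneg hz₀.1 j)
        rw [hj]
        linarith [hrM j]
      refine Finset.sum_lt_sum (fun i _ => ?_) ⟨j, Finset.mem_univ j, by simpa using hjlt⟩
      split_ifs with hij
      · subst hij
        exact hjlt.le
      · simpa using hterm i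
    rw [Finset.sum_sub_distrib, Finset.sum_ite_eq', if_pos (Finset.mem_univ j), sub_self] at hsum
    exact hsum.not_ge h0
  refine ⟨z, hzK.1, hKD z hzK, fun w hw => hseg w hw ?_⟩
  refine eventually_all.2 fun i => ?_
  have hc : Continuous fun t : ℝ => F (z + t • (w - z)) i :=
    (continuous_flowOf i).comp (by fun_prop)
  have := (hc.tendsto' 0 (F z i) (by simp)).eventually_lt_const (hlt i)
  exact (this.filter_mono nhdsWithin_le_nhds).mono fun t ht => ht.le

lemma sum_mul_pathCost (φ ω : E → ℝ → ℝ) (y : E → ℝ) (w : Path θ κ o d → ℝ) :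
    ∑ γ, w γ * pathCost θ κ o d φ ω y γ =
      ∑ i, (latency (φ i) (y i) + ω i (y i)) * flowOf θ κ o d w i := by
  simp only [pathCost, flowOf, Finset.mul_sum]
  rw [Finset.sum_comm]
  exact Finset.sum_congr rfl fun i _ => Finset.sum_congr rfl fun γ _ => by ring

/-- Wardrop equilibria are the solutions of a variational inequality in the link flows. -/
lemma wardrop_iff_variational [Nonempty (Path θ κ o d)] (φ ω : E → ℝ → ℝ) {lam : ℝ}
    {z : Path θ κ o d → ℝ} (hz : z ∈ pathSimplex lam (Path θ κ o d)) {y : E → ℝ}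
    (hy : ∀ i, y i = flowOf θ κ o d z i) :
    (∀ γ, 0 < z γ → ∀ γ', pathCost θ κ o d φ ω y γ ≤ pathCost θ κ o d φ ω y γ') ↔
      ∀ w ∈ pathSimplex lam (Path θ κ o d),
        0 ≤ ∑ i, (latency (φ i) (y i) + ω i (y i)) * (flowOf θ κ o d w i - y i) := by
  rw [supported_on_min_iff hz]
  refine forall₂_congr fun w _ => ?_
  simp only [sum_mul_pathCost, mul_sub, Finset.sum_sub_distrib, sub_nonneg, ← hy]

lemma flowOf_mem_eqFlow [DecidableEq V] (hloop : ∀ i, θ i ≠ κ i) {lam : ℝ}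
    {z : Path θ κ o d → ℝ} (hz : z ∈ pathSimplex lam (Path θ κ o d)) :
    flowOf θ κ o d z ∈ eqFlow θ κ o d lam := by
  refine ⟨flowOf_nonneg hz.1, fun v => ?_⟩
  simp only [flowOf, Finset.mul_sum]
  rw [Finset.sum_comm, ← hz.2, Finset.sum_mul]
  refine Finset.sum_congr rfl fun γ _ => ?_
  rw [← sum_Bmat_mul_Amat hloop v γ, Finset.mul_sum]
  exact Finset.sum_congr rfl fun i _ => by ring

lemma IsGWE.unique [DecidableEq V] [Nonempty (Path θ κ o d)] {φ ω : E → ℝ → ℝ}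
    (hf : ∀ i, LinkCost (fun y => latency (φ i) y + ω i y) (latDom (φ i)))
    {lam : ℝ} {y y' : E → ℝ} (h : IsGWE θ κ o d φ ω lam y)
    (h' : IsGWE θ κ o d φ ω lam y') : y = y' := by
  obtain ⟨hy, -, z, hz, hyz, hw⟩ := h
  obtain ⟨hy', -, z', hz', hyz', hw'⟩ := h'
  have h1 := (wardrop_iff_variational φ ω hz hyz).1 hw z' hz'
  have h2 := (wardrop_iff_variational φ ω hz' hyz').1 hw' z hz
  simp only [← hyz, ← hyz'] at h1 h2
  by_contra hne
  obtain ⟨j, hj⟩ := Function.ne_iff.1 hne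
  set f : E → ℝ → ℝ := fun i y => latency (φ i) y + ω i y
  have hlt : ∀ i, y i ≠ y' i → 0 < (f i (y i) - f i (y' i)) * (y i - y' i) := by
    intro i hi
    rcases hi.lt_or_gt with hi | hi
    · exact mul_pos_of_neg_of_neg (sub_neg.2 ((hf i).strictMonoOn (hy i) (hy' i) hi))
        (sub_neg.2 hi)
    · exact mul_pos (sub_pos.2 ((hf i).strictMonoOn (hy' i) (hy i) hi)) (sub_pos.2 hi)
  have hpos : 0 < ∑ i, (f i (y i) - f i (y' i)) * (y i - y' i) := by
    refine Finset.sum_pos' (fun i _ => ?_) ⟨j, Finset.mem_univ j, hlt j hj⟩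
    by_cases hi : y i = y' i
    · simp [hi]
    · exact (hlt i hi).le
  have heq : ∑ i, (f i (y i) - f i (y' i)) * (y i - y' i) =
      -(∑ i, f i (y i) * (y' i - y i) + ∑ i, f i (y' i) * (y i - y' i)) := by
    rw [← Finset.sum_add_distrib, ← Finset.sum_neg_distrib]
    exact Finset.sum_congr rfl fun i _ => by ring
  linarith

end Network

/-- As the noise vanishes (`β → ∞`), the perturbed equilibrium flows
`y^{(ω,β)} = A z^β`, where `z^β` is the unique minimizer of the entropic objective over
`Z_β`, converge to the unique generalized Wardrop equilibrium `y^{(ω)}`. -/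
theorem perturbed_equilibria_tendsto_wardrop {V E : Type*} [Fintype V] [Fintype E]
    [DecidableEq V] [DecidableEq E] (θ κ : E → V) (hloop : ∀ i, θ i ≠ κ i)
    (o d : V) (hod : d ≠ o) [Fintype (Path θ κ o d)]
    (hreach : Nonempty (Path θ κ o d))
    (hcover : ∀ i : E, ∃ γ : Path θ κ o d, i ∈ γ.1)
    (φ : E → ℝ → ℝ) (hφ : ∀ i, Standing (φ i))
    (ω : E → ℝ → ℝ) (hmon : MonotonePolicy φ ω) (hlip : LipschitzPolicy φ ω)
    (lam : ℝ) (hlam0 : 0 ≤ lam) (hlam : ENNReal.ofReal lam < minCut θ κ o d φ)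
    (Zb : ℝ → Set (Path θ κ o d → ℝ))
    (hZb : ∀ β > (0:ℝ), (Zb β).Nonempty ∧ IsCompact (Zb β) ∧ Convex ℝ (Zb β) ∧
      Zb β ⊆ Zint θ κ o d φ lam ∧
      ∀ i, ∃ c : ℝ, ENNReal.ofReal c < cap (φ i) ∧ ∀ z ∈ Zb β, flowOf θ κ o d z i ≤ c)
    (hconv : Tendsto (fun β => Metric.hausdorffDist (Zb β)
        (closure (Zfeas θ κ o d φ lam))) atTop (nhds 0))
    (zB : ℝ → Path θ κ o d → ℝ)
    (hzB : ∀ β > (0:ℝ), zB β ∈ Zb β ∧ ∀ z ∈ Zb β, z ≠ zB β →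
      entObj θ κ o d φ ω β (zB β) < entObj θ κ o d φ ω β z) :
    ∃ yw, IsGWE θ κ o d φ ω lam yw ∧ (∀ y', IsGWE θ κ o d φ ω lam y' → y' = yw) ∧
      Tendsto (fun β => fun i => flowOf θ κ o d (zB β) i) atTop (nhds yw) := by
  have hf : ∀ i, LinkCost (fun y => latency (φ i) y + ω i y) (latDom (φ i)) := fun i =>
    (hφ i).linkCost (hmon i).1 (hmon i).2 (hlip i).choose_spec.continuousOn
  have hZb_sub : ∀ β > 0, Zb β ⊆ Zfeas θ κ o d φ lam := fun β hβ z hz => ((hZb β hβ).2.2.2.1 hz).1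
  obtain ⟨z₀, hz₀⟩ := (hZb 1 one_pos).1
  have hz₀ := hZb_sub 1 one_pos hz₀
  obtain ⟨z, hz, hzD, hvar⟩ := exists_variational_equilibrium hf hz₀.1 hz₀.2
  have hzZ : z ∈ Zfeas θ κ o d φ lam := ⟨hz, hzD⟩
  have hgwe : IsGWE θ κ o d φ ω lam (flowOf θ κ o d z) :=
    ⟨hzD, flowOf_mem_eqFlow hloop hz, z, hz, fun _ => rfl,
      (wardrop_iff_variational φ ω hz fun _ => rfl).2 hvar⟩
  refine ⟨_, hgwe, fun y' hy' => hy'.unique hf hgwe, tendsto_pi_nhds.2 fun j => ?_⟩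
  have hcont : ContinuousOn (Theta θ κ o d φ ω) (Zfeas θ κ o d φ lam) :=
    continuousOn_finsetSum _ fun i _ => (hf i).continuousOn_integral.comp
      (continuous_flowOf i).continuousOn fun w hw => hw.2 i
  obtain ⟨K, hK⟩ := exists_entropy_bound (Γ := Path θ κ o d) lam
  have hbdd : Bornology.IsBounded (Zfeas θ κ o d φ lam) :=
    (isCompact_pathSimplex lam).isBounded.subset fun w hw => hw.1
  -- The values of the potential along the minimizers do not exceed its minimum in the limit.
  have hvalue : ∀ δ > 0, ∀ᶠ β in atTop,
      Theta θ κ o d φ ω (zB β) < Theta θ κ o d φ ω z + δ := by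
    intro δ hδ
    obtain ⟨r, hr, hrδ⟩ := Metric.continuousOn_iff.1 hcont z hzZ (δ / 2) (half_pos hδ)
    have hsmall : Tendsto (fun β : ℝ => β⁻¹ * (2 * K)) atTop (𝓝 0) := by
      simpa using tendsto_inv_atTop_zero.mul_const (2 * K)
    filter_upwards [hconv.eventually_lt_const hr, hsmall.eventually_lt_const (half_pos hδ),
      eventually_gt_atTop 0] with β hβr hβK hβ
    obtain ⟨w, hw, hwz⟩ := Metric.exists_dist_lt_of_hausdorffDist_lt' (subset_closure hzZ) hβr
      (Metric.hausdorffEDist_ne_top_of_nonempty_of_bounded (hZb β hβ).1 ⟨z, subset_closure hzZ⟩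
        (hZb β hβ).2.1.isBounded hbdd.closure)
    have hwΘ := (abs_lt.1 (hrδ w (hZb_sub β hβ hw) hwz)).2
    have hle : entObj θ κ o d φ ω β (zB β) ≤ entObj θ κ o d φ ω β w := by
      by_cases hwe : w = zB β
      · rw [hwe]
      · exact ((hzB β hβ).2 w hw hwe).le
    have h1 := abs_le.1 (hK _ (hZb_sub β hβ (hzB β hβ).1).1)
    have h2 := abs_le.1 (hK _ (hZb_sub β hβ hw).1)
    have h3 : β⁻¹ * ((∑ γ, w γ * Real.log (w γ)) - ∑ γ, zB β γ * Real.log (zB β γ)) ≤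
        β⁻¹ * (2 * K) := mul_le_mul_of_nonneg_left (by linarith) (inv_pos.2 hβ).le
    unfold entObj at hle
    linarith
  rw [Metric.tendsto_nhds]
  intro ε hε
  obtain ⟨δ, hδ, hgap⟩ := (hf j).exists_gap (hzD j) hε
  filter_upwards [hvalue δ hδ, eventually_gt_atTop 0] with β hβδ hβ
  have hb := hZb_sub β hβ (hzB β hβ).1
  refine hgap _ (hb.2 j) ?_
  have hsingle := Finset.single_le_sum (s := Finset.univ) (fun i _ => sub_nonneg.2
    ((hf i).mul_le_integral_sub (hzD i) (hb.2 i))) (Finset.mem_univ j)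
  rw [Finset.sum_sub_distrib, Finset.sum_sub_distrib] at hsingle
  have hv := hvar _ hb.1
  refine hsingle.trans_lt ?_
  unfold Theta at hβδ
  linarith

end Traffic
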